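/- Let k be a field, R = k[X,Y], m = (X,Y), and let I be a proper ideal generated by monomials with m^r ⊆ I ⊆ m for some r ≥ 1. Let g = dim_k (I/mI) be the minimal number of (monomial) generators of I and n = dim_k (R/I). Then g(g−1)/2 ≤ n. -/

import Mathlib

open MvPolynomial

/-- `dim_k (I / mI)` where `m = (X, Y)`: the minimal number of generators of `I`. -/
noncomputable def gensDim {k : Type*} [Field k] (I : Ideal (MvPolynomial (Fin 2) k)) : ℕ :=
  Module.finrank k
    (↥(I.restrictScalars k) ⧸
      (Submodule.comap (I.restrictScalars k).subtype
        ((Ideal.span {X 0, X 1} * I).restrictScalars k)))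

namespace MvPolynomial

variable {k : Type*} [Field k]

/-- The ideal of `k[X, Y]` generated by the monomials with exponents in `T`. -/
noncomputable def monomialIdeal (k : Type*) [Field k] (T : Set (Fin 2 →₀ ℕ)) :
    Ideal (MvPolynomial (Fin 2) k) :=
  Ideal.span ((fun d => monomial d (1 : k)) '' T)

theorem mem_monomialIdeal {T : Set (Fin 2 →₀ ℕ)} {p : MvPolynomial (Fin 2) k} :
    p ∈ monomialIdeal k T ↔ ∀ d ∈ p.support, ∃ t ∈ T, t ≤ d :=
  mem_ideal_span_monomial_image

theorem X_zero_pow_mul_X_one_pow (a b : ℕ) :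
    (X 0 : MvPolynomial (Fin 2) k) ^ a * X 1 ^ b =
      monomial (Finsupp.single 0 a + Finsupp.single 1 b) 1 := by
  simp [X_pow_eq_monomial, monomial_mul]

theorem eq_single_zero_add_single_one (d : Fin 2 →₀ ℕ) :
    d = Finsupp.single 0 (d 0) + Finsupp.single 1 (d 1) := by
  ext i
  fin_cases i <;> simp

theorem monomial_mem_span_X {d : Fin 2 →₀ ℕ} (hd : d ≠ 0) (c : k) :
    monomial d c ∈ (Ideal.span {X 0, X 1} : Ideal (MvPolynomial (Fin 2) k)) := by
  have hX : ({X 0, X 1} : Set (MvPolynomial (Fin 2) k)) = X '' Set.univ := by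
    ext p
    simp [Fin.exists_fin_two, eq_comm]
  rw [hX, mem_ideal_span_X_image]
  intro m hm
  obtain rfl : d = m := by
    simpa using (Finset.mem_singleton.mp (support_monomial_subset hm)).symm
  obtain ⟨i, hi⟩ := Finsupp.ne_iff.mp hd
  exact ⟨i, Set.mem_univ i, hi⟩

/-- A monomial whose exponent lies strictly above an element of `T` lies in `m` times the
monomial ideal of `T`. -/
theorem monomial_mem_span_X_mul_monomialIdeal {T : Set (Fin 2 →₀ ℕ)} {t d : Fin 2 →₀ ℕ}
    (ht : t ∈ T) (htd : t < d) (c : k) :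
    monomial d c ∈ Ideal.span {X 0, X 1} * monomialIdeal k T := by
  have hne : d - t ≠ 0 := fun h => htd.not_ge (tsub_eq_zero_iff_le.mp h)
  have hmul : monomial d c = monomial (d - t) c * monomial t (1 : k) := by
    rw [monomial_mul, tsub_add_cancel_of_le htd.le, mul_one]
  rw [hmul]
  exact Ideal.mul_mem_mul (monomial_mem_span_X hne c) (Ideal.subset_span ⟨t, ht, rfl⟩)

/-- If `t ∈ T`, then the minimal elements of `T` embed into `Fin (t 0 + t 1 + 1)`: each one other
than `t` is determined by a first coordinate below `t 0` or a second coordinate below `t 1`. -/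
theorem exists_injective_minimal_fin {T : Set (Fin 2 →₀ ℕ)} {t : Fin 2 →₀ ℕ} (ht : t ∈ T) :
    ∃ f : {d // Minimal (· ∈ T) d} → Fin (t 0 + t 1 + 1), Function.Injective f := by
  have hle (d e : Fin 2 →₀ ℕ) : d ≤ e ↔ d 0 ≤ e 0 ∧ d 1 ≤ e 1 := by
    rw [Finsupp.le_def, Fin.forall_fin_two]
  refine ⟨fun d => ⟨if d.1 0 < t 0 then d.1 0 else if d.1 1 < t 1 then t 0 + 1 + d.1 1 else t 0,
    by split_ifs <;> omega⟩, ?_⟩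
  rintro ⟨d, hd⟩ ⟨e, he⟩ h
  have hde : d ≤ e → d = e := fun hl => hl.antisymm (he.2 hd.1 hl)
  have hed : e ≤ d → d = e := fun hl => (hd.2 he.1 hl).antisymm hl
  have htd : t ≤ d → d ≤ t := fun hl => hd.2 ht hl
  have hte : t ≤ e → e ≤ t := fun hl => he.2 ht hl
  simp only [hle, Fin.mk.injEq, Subtype.mk.injEq] at h hde hed htd hte ⊢
  split_ifs at h
  all_goals
    by_cases h1 : d 1 ≤ e 1 <;> by_cases h0 : d 0 ≤ e 0 <;>
      first
      | exact hde (by omega)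
      | exact hed (by omega)

/-- The minimal number of generators of a monomial ideal containing `X ^ a * Y ^ b` is at most
`a + b + 1`. -/
theorem gensDim_monomialIdeal_le {T : Set (Fin 2 →₀ ℕ)} {t : Fin 2 →₀ ℕ} (ht : t ∈ T) :
    gensDim (monomialIdeal k T) ≤ t 0 + t 1 + 1 := by
  obtain ⟨f, hf⟩ := exists_injective_minimal_fin ht
  have : Fintype {d // Minimal (· ∈ T) d} := Fintype.ofInjective f hf
  set I := (monomialIdeal k T).restrictScalars k with hI
  set N := Submodule.comap I.subtype
    ((Ideal.span {X 0, X 1} * monomialIdeal k T).restrictScalars k) with hN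
  have hmon (d : {d // Minimal (· ∈ T) d}) : monomial d.1 (1 : k) ∈ I :=
    Ideal.subset_span ⟨d.1, d.2.1, rfl⟩
  let v (d : {d // Minimal (· ∈ T) d}) : ↥I ⧸ N := N.mkQ ⟨monomial d.1 1, hmon d⟩
  have hterm (d : Fin 2 →₀ ℕ) (c : k) (h : monomial d c ∈ I) :
      N.mkQ ⟨monomial d c, h⟩ ∈ Submodule.span k (Set.range v) := by
    by_cases hlt : ∃ s ∈ T, s < d
    · obtain ⟨s, hs, hsd⟩ := hlt
      have h0 : N.mkQ ⟨monomial d c, h⟩ = 0 := by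
        rw [Submodule.mkQ_apply, Submodule.Quotient.mk_eq_zero]
        exact monomial_mem_span_X_mul_monomialIdeal hs hsd c
      rw [h0]
      exact zero_mem _
    · by_cases hc : c = 0
      · subst hc
        have h0 : (⟨monomial d 0, h⟩ : I) = 0 := Subtype.ext (monomial_zero)
        rw [h0, map_zero]
        exact zero_mem _
      · push Not at hlt
        obtain ⟨s, hs, hsd⟩ := mem_monomialIdeal.mp h d (by simp [hc])
        obtain rfl : s = d := hsd.eq_of_not_lt (hlt s hs)
        have hmin : Minimal (· ∈ T) s :=
          ⟨hs, fun e he hes => (hes.eq_of_not_lt (hlt e he)).ge⟩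
        have hsmul : (⟨monomial s c, h⟩ : I) = c • ⟨monomial s 1, hmon ⟨s, hmin⟩⟩ :=
          Subtype.ext (by simp [smul_monomial])
        rw [hsmul, map_smul]
        exact Submodule.smul_mem _ _ (Submodule.subset_span ⟨⟨s, hmin⟩, rfl⟩)
  have hspan : Submodule.span k (Set.range v) = ⊤ := by
    rw [eq_top_iff]
    rintro x -
    obtain ⟨⟨p, hp⟩, rfl⟩ := N.mkQ_surjective x
    have hmem (d : Fin 2 →₀ ℕ) : monomial d (coeff d p) ∈ I := by
      refine mem_monomialIdeal.mpr fun e he => ?_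
      rw [mem_support_iff, coeff_monomial] at he
      split_ifs at he with hde
      · subst hde
        exact mem_monomialIdeal.mp hp d (mem_support_iff.mpr he)
      · exact absurd rfl he
    have hsum : (⟨p, hp⟩ : I) = ∑ d ∈ p.support, ⟨monomial d (coeff d p), hmem d⟩ := by
      apply Subtype.ext
      rw [AddSubmonoidClass.coe_finsetSum]
      exact p.as_sum
    rw [hsum, map_sum]
    exact Submodule.sum_mem _ fun d _ => hterm d _ _
  calc gensDim (monomialIdeal k T) ≤ Fintype.card {d // Minimal (· ∈ T) d} :=
        finrank_le_of_span_eq_top hspan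
    _ ≤ t 0 + t 1 + 1 := by simpa using Fintype.card_le_of_injective f hf

/-- `k[X, Y] / I` is finite-dimensional when `I` contains a power of `m`. -/
theorem finite_quotient_of_span_X_pow_le {I : Ideal (MvPolynomial (Fin 2) k)} {r : ℕ}
    (h : (Ideal.span {X 0, X 1} : Ideal (MvPolynomial (Fin 2) k)) ^ r ≤ I) :
    Module.Finite k (MvPolynomial (Fin 2) k ⧸ I) := by
  have hpow (i : Fin 2) : (X i : MvPolynomial (Fin 2) k) ^ r ∈ I :=
    h (Ideal.pow_mem_pow (Ideal.subset_span (by fin_cases i <;> simp)) r)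
  let v (q : Fin r × Fin r) : MvPolynomial (Fin 2) k ⧸ I :=
    Ideal.Quotient.mkₐ k I (X 0 ^ (q.1 : ℕ) * X 1 ^ (q.2 : ℕ))
  suffices hspan : Submodule.span k (Set.range v) = ⊤ from
    ⟨hspan ▸ Submodule.fg_span (Set.finite_range v)⟩
  rw [eq_top_iff]
  rintro x -
  obtain ⟨p, rfl⟩ := Ideal.Quotient.mkₐ_surjective k I x
  induction p using MvPolynomial.induction_on' with
  | add p q hp hq =>
    rw [map_add]
    exact add_mem hp hq
  | monomial d c =>
    have hd : monomial d c = c • ((X 0 : MvPolynomial (Fin 2) k) ^ d 0 * X 1 ^ d 1) := by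
      rw [X_zero_pow_mul_X_one_pow, ← eq_single_zero_add_single_one, smul_monomial, smul_eq_mul,
        mul_one]
    rw [hd, map_smul]
    refine Submodule.smul_mem _ _ ?_
    by_cases hlt : d 0 < r ∧ d 1 < r
    · exact Submodule.subset_span ⟨(⟨d 0, hlt.1⟩, ⟨d 1, hlt.2⟩), rfl⟩
    · have hmem : (X 0 : MvPolynomial (Fin 2) k) ^ d 0 * X 1 ^ d 1 ∈ I := by
        rcases not_and_or.mp hlt with h0 | h1
        · exact I.mul_mem_right _ (I.mem_of_dvd (pow_dvd_pow _ (not_lt.mp h0)) (hpow 0))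
        · exact I.mul_mem_left _ (I.mem_of_dvd (pow_dvd_pow _ (not_lt.mp h1)) (hpow 1))
      rw [Ideal.Quotient.mkₐ_eq_mk, Ideal.Quotient.eq_zero_iff_mem.mpr hmem]
      exact zero_mem _

/-- If every exponent in `T` has degree at least `n`, then the monomials of degree less than `n`
are linearly independent modulo the monomial ideal of `T`. -/
theorem le_finrank_quotient_monomialIdeal {T : Set (Fin 2 →₀ ℕ)} {n : ℕ}
    (hT : ∀ t ∈ T, n ≤ t 0 + t 1)
    [Module.Finite k (MvPolynomial (Fin 2) k ⧸ monomialIdeal k T)] :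
    (n + 1) * n / 2 ≤ Module.finrank k (MvPolynomial (Fin 2) k ⧸ monomialIdeal k T) := by
  let e (q : Σ i : Fin n, Fin (i + 1)) : Fin 2 →₀ ℕ :=
    Finsupp.single 0 (q.2 : ℕ) + Finsupp.single 1 ((q.1 : ℕ) - q.2)
  have he0 (q) : e q 0 = q.2 := by simp [e]
  have he1 (q) : e q 1 = q.1 - q.2 := by simp [e]
  have hinj : Function.Injective e := by
    rintro ⟨i, j⟩ ⟨i', j'⟩ h
    have h0 := DFunLike.congr_fun h 0
    have h1 := DFunLike.congr_fun h 1
    simp only [he0, he1] at h0 h1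
    obtain rfl : i = i' := by ext; omega
    obtain rfl : j = j' := by ext; omega
    rfl
  have hli : LinearIndependent k
      (fun q => Ideal.Quotient.mkₐ k (monomialIdeal k T) (monomial (e q) (1 : k))) := by
    rw [Fintype.linearIndependent_iff]
    intro c hc q
    by_contra hq
    simp_rw [← map_smul, ← map_sum, Ideal.Quotient.mkₐ_eq_mk] at hc
    rw [Ideal.Quotient.eq_zero_iff_mem] at hc
    obtain ⟨t, ht, htq⟩ := mem_monomialIdeal.mp hc (e q) (by
      simpa [mem_support_iff, coeff_sum, coeff_monomial, hinj.eq_iff] using hq)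
    have h0 := htq 0
    have h1 := htq 1
    rw [he0] at h0
    rw [he1] at h1
    have := hT t ht
    omega
  have hcard : Fintype.card (Σ i : Fin n, Fin (i + 1)) = (n + 1) * n / 2 := by
    rw [Fintype.card_sigma]
    simp only [Fintype.card_fin]
    have hsum := Finset.sum_range_id (n + 1)
    rw [Finset.sum_range_succ', add_zero, Nat.add_sub_cancel] at hsum
    rw [Fin.sum_univ_eq_sum_range (fun i => i + 1) n, hsum]
  rw [← hcard]
  exact hli.fintype_card_le_finrank

end MvPolynomial

/-- For an `m`-primary monomial ideal `I ⊆ k[X,Y]` with `g = dim_k(I/mI)` minimal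
generators and colength `n = dim_k(R/I)`, one has `g(g−1)/2 ≤ n`. -/
theorem monomial_choose_gens_two_le {k : Type*} [Field k]
    (I : Ideal (MvPolynomial (Fin 2) k))
    (hmono : ∃ S : Set (ℕ × ℕ),
      I = Ideal.span ((fun p : ℕ × ℕ => (X 0 : MvPolynomial (Fin 2) k) ^ p.1 * X 1 ^ p.2) '' S))
    (r : ℕ) (hr : 1 ≤ r)
    (hmI : (Ideal.span {X 0, X 1} : Ideal (MvPolynomial (Fin 2) k)) ^ r ≤ I)
    (hIm : I ≤ Ideal.span {X 0, X 1}) :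
    gensDim I * (gensDim I - 1) / 2 ≤ Module.finrank k (MvPolynomial (Fin 2) k ⧸ I) := by
  obtain ⟨S, hS⟩ := hmono
  obtain ⟨T, rfl⟩ : ∃ T, I = monomialIdeal k T := by
    refine ⟨(fun p : ℕ × ℕ => Finsupp.single 0 p.1 + Finsupp.single 1 p.2) '' S, ?_⟩
    rw [hS, monomialIdeal, Set.image_image]
    simp_rw [X_zero_pow_mul_X_one_pow]
  have hne : T.Nonempty := by
    have hX : (X 0 : MvPolynomial (Fin 2) k) ^ r ∈ monomialIdeal k T :=
      hmI (Ideal.pow_mem_pow (Ideal.subset_span (by simp)) r)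
    obtain ⟨t, ht, -⟩ := mem_monomialIdeal.mp hX (Finsupp.single 0 r)
      (by simp [X_pow_eq_monomial])
    exact ⟨t, ht⟩
  obtain ⟨t, ht, hmin⟩ := exists_minimalFor_of_wellFoundedLT (· ∈ T) (fun t => t 0 + t 1) hne
  have hT : ∀ s ∈ T, t 0 + t 1 ≤ s 0 + s 1 := fun s hs =>
    (le_total (t 0 + t 1) (s 0 + s 1)).elim id (hmin hs)
  have := finite_quotient_of_span_X_pow_le hmI
  have hg := gensDim_monomialIdeal_le (k := k) ht
  calc gensDim (monomialIdeal k T) * (gensDim (monomialIdeal k T) - 1) / 2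
      ≤ (t 0 + t 1 + 1) * (t 0 + t 1) / 2 :=
        Nat.div_le_div_right (Nat.mul_le_mul hg (by omega))
    _ ≤ _ := le_finrank_quotient_monomialIdeal hT
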